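/- Let Λ^{k} ∈ ℝ^{H×D} stack the honest dual iterates (λ_i^{k})_{i∈𝓗} generated by the Byzantine-resilient algorithm from a common initialization λ⁰. Suppose the contraction constant satisfies ρ < (1−κ)/(8√H), so that ε := 1 − κ − 8ρ√H > 0, and the step sizes satisfy 18(γ^k)²/(ε·u_f²J²) ≤ (2−ε)ε²/(3(3−ε)) and 1 ≤ (γ^k)²/(γ^{k+1})² ≤ 2/(2−ε²) for all k ≥ 0. Then for all k ≥ 0: ‖Λ^{k+1} − (1/H)11ᵀΛ^{k+1}‖_F² ≤ 18(γ^{k+1})²δ²H³/(ε³·J²). -/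

import Mathlib

open Filter Finset
open scoped BigOperators Topology InnerProductSpace

section NormedGroup

variable {ι V : Type*} [NormedAddCommGroup V]

theorem norm_add_sq_le_young (a b : V) {t : ℝ} (ht : 0 < t) :
    ‖a + b‖ ^ 2 ≤ (1 + t) * ‖a‖ ^ 2 + (1 + t⁻¹) * ‖b‖ ^ 2 := by
  have h1 := pow_le_pow_left₀ (norm_nonneg _) (norm_add_le a b) 2
  have h2 : (1 + t) * ‖a‖ ^ 2 + (1 + t⁻¹) * ‖b‖ ^ 2 - (‖a‖ + ‖b‖) ^ 2
      = t⁻¹ * (t * ‖a‖ - ‖b‖) ^ 2 := by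
    field_simp; ring
  have h3 : 0 ≤ t⁻¹ * (t * ‖a‖ - ‖b‖) ^ 2 := by positivity
  linarith

theorem sum_norm_add_sq_le [Fintype ι] (a b : ι → V) {A B : ℝ} (hA : 0 ≤ A) (hB : 0 ≤ B)
    (ha : ∑ i, ‖a i‖ ^ 2 ≤ A ^ 2) (hb : ∑ i, ‖b i‖ ^ 2 ≤ B ^ 2) :
    ∑ i, ‖a i + b i‖ ^ 2 ≤ (A + B) ^ 2 := by
  have hsq : ∀ v : ι → V, ‖(WithLp.toLp 2 v : PiLp 2 fun _ : ι => V)‖ ^ 2 = ∑ i, ‖v i‖ ^ 2 :=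
    fun v => PiLp.norm_sq_eq_of_L2 _ _
  rw [← hsq] at ha hb
  have ha' := (sq_le_sq₀ (norm_nonneg _) hA).1 ha
  have hb' := (sq_le_sq₀ (norm_nonneg _) hB).1 hb
  calc ∑ i, ‖a i + b i‖ ^ 2 = ‖(WithLp.toLp 2 a + WithLp.toLp 2 b : PiLp 2 fun _ : ι => V)‖ ^ 2 :=
        (hsq (a + b)).symm
    _ ≤ (A + B) ^ 2 := by
        gcongr
        exact (norm_add_le _ _).trans (add_le_add ha' hb')

theorem norm_sub_le_sqrt_sum [Fintype ι] (y : ι → V) (m : V) (i : ι) :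
    ‖y i - m‖ ≤ √(∑ j, ‖y j - m‖ ^ 2) :=
  Real.le_sqrt_of_sq_le
    (Finset.single_le_sum (f := fun j => ‖y j - m‖ ^ 2) (fun _ _ => sq_nonneg _) (mem_univ i))

end NormedGroup

section InnerProduct

variable {ι V : Type*} [Fintype ι] [NormedAddCommGroup V] [InnerProductSpace ℝ V]

theorem sum_norm_sub_mean_sq_le [Nonempty ι] (x : ι → V) (c : V) :
    ∑ i, ‖x i - (Fintype.card ι : ℝ)⁻¹ • ∑ j, x j‖ ^ 2 ≤ ∑ i, ‖x i - c‖ ^ 2 := by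
  set m := (Fintype.card ι : ℝ)⁻¹ • ∑ j, x j with hm
  have hcard : (Fintype.card ι : ℝ) ≠ 0 := by exact_mod_cast Fintype.card_ne_zero
  have hzero : ∑ i, (x i - m) = 0 := by
    rw [Finset.sum_sub_distrib, Finset.sum_const, Finset.card_univ, ← Nat.cast_smul_eq_nsmul ℝ,
      hm, smul_smul, mul_inv_cancel₀ hcard, one_smul, sub_self]
  have hexpand : ∀ i, ‖x i - c‖ ^ 2
      = ‖x i - m‖ ^ 2 + 2 * ⟪x i - m, m - c⟫_ℝ + ‖m - c‖ ^ 2 := fun i => by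
    rw [← norm_add_sq_real, sub_add_sub_cancel]
  have hsum : ∑ i, ‖x i - c‖ ^ 2 = ∑ i, ‖x i - m‖ ^ 2 + ∑ _i : ι, ‖m - c‖ ^ 2 := by
    simp only [hexpand, Finset.sum_add_distrib, ← Finset.mul_sum, ← sum_inner, hzero,
      inner_zero_left, mul_zero, add_zero]
  rw [hsum]
  exact le_add_of_nonneg_right (Finset.sum_nonneg fun _ _ => sq_nonneg _)

theorem sum_norm_matrix_smul_sq_le {d : Type*} [Fintype d] [DecidableEq ι] (M : Matrix ι ι ℝ)
    (x : ι → EuclideanSpace ℝ d) :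
    ∑ i, ‖∑ j, M i j • x j‖ ^ 2 ≤
      ‖LinearMap.toContinuousLinearMap (Matrix.toEuclideanLin M)‖ ^ 2 * ∑ i, ‖x i‖ ^ 2 := by
  set L := LinearMap.toContinuousLinearMap (Matrix.toEuclideanLin M)
  have hcoord : ∀ d, ∑ i, (∑ j, M i j * x j d) ^ 2 ≤ ‖L‖ ^ 2 * ∑ i, x i d ^ 2 := fun d => by
    have h := L.le_opNorm (WithLp.toLp 2 fun j => x j d)
    have h2 := pow_le_pow_left₀ (norm_nonneg _) h 2
    rw [mul_pow, EuclideanSpace.real_norm_sq_eq, EuclideanSpace.real_norm_sq_eq] at h2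
    exact h2
  simp only [EuclideanSpace.real_norm_sq_eq, WithLp.ofLp_sum, Finset.sum_apply, PiLp.smul_apply,
    smul_eq_mul]
  rw [Finset.sum_comm, Finset.sum_comm (s := Finset.univ) (t := Finset.univ)
    (f := fun i d => x i d ^ 2), Finset.mul_sum]
  exact Finset.sum_le_sum fun d _ => hcoord d

theorem StrongConvexOn.add_sq_le_of_isMinOn {f : V → ℝ} {u : ℝ} (hf : StrongConvexOn Set.univ u f)
    {C : Set V} (hC : Convex ℝ C) {l p q : V} (hp : p ∈ C) (hq : q ∈ C)
    (hmin : ∀ θ ∈ C, ⟪l, p⟫_ℝ + f p ≤ ⟪l, θ⟫_ℝ + f θ) :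
    ⟪l, p⟫_ℝ + f p + u / 2 * ‖p - q‖ ^ 2 ≤ ⟪l, q⟫_ℝ + f q := by
  have hseg : ∀ t ∈ Set.Ioo (0 : ℝ) 1,
      ⟪l, p⟫_ℝ + f p + (1 - t) * (u / 2 * ‖p - q‖ ^ 2) ≤ ⟪l, q⟫_ℝ + f q := by
    rintro t ⟨ht0, ht1⟩
    have h1 := hmin _ (hC hp hq (sub_nonneg.2 ht1.le) ht0.le (sub_add_cancel 1 t))
    have h2 := hf.2 (Set.mem_univ p) (Set.mem_univ q) (sub_nonneg.2 ht1.le) ht0.le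
      (sub_add_cancel 1 t)
    simp only [smul_eq_mul] at h2
    rw [inner_add_right, inner_smul_right, inner_smul_right] at h1
    refine le_of_mul_le_mul_left ?_ ht0
    nlinarith
  have hlim : Tendsto (fun t : ℝ => ⟪l, p⟫_ℝ + f p + (1 - t) * (u / 2 * ‖p - q‖ ^ 2)) (𝓝[>] 0)
      (𝓝 (⟪l, p⟫_ℝ + f p + (1 - 0) * (u / 2 * ‖p - q‖ ^ 2))) :=
    (Continuous.tendsto (by fun_prop) 0).mono_left nhdsWithin_le_nhds
  rw [sub_zero, one_mul] at hlim
  refine le_of_tendsto hlim ?_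
  filter_upwards [Ioo_mem_nhdsGT zero_lt_one] with t ht using hseg t ht

theorem StrongConvexOn.mul_norm_sub_le_of_isMinOn {f : V → ℝ} {u : ℝ}
    (hf : StrongConvexOn Set.univ u f)
    {C : Set V} (hC : Convex ℝ C) {l l' p q : V} (hp : p ∈ C) (hq : q ∈ C)
    (hpmin : ∀ θ ∈ C, ⟪l, p⟫_ℝ + f p ≤ ⟪l, θ⟫_ℝ + f θ)
    (hqmin : ∀ θ ∈ C, ⟪l', q⟫_ℝ + f q ≤ ⟪l', θ⟫_ℝ + f θ) :
    u * ‖p - q‖ ≤ ‖l - l'‖ := by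
  have h1 := hf.add_sq_le_of_isMinOn hC hp hq hpmin
  have h2 := hf.add_sq_le_of_isMinOn hC hq hp hqmin
  rw [norm_sub_rev q p] at h2
  have h3 : ⟪l - l', q - p⟫_ℝ = ⟪l, q⟫_ℝ - ⟪l, p⟫_ℝ - (⟪l', q⟫_ℝ - ⟪l', p⟫_ℝ) := by
    simp only [inner_sub_left, inner_sub_right]; ring
  have h4 := real_inner_le_norm (l - l') (q - p)
  rw [norm_sub_rev q p] at h4
  rcases (norm_nonneg (p - q)).eq_or_lt with h0 | h0
  · rw [← h0, mul_zero]; exact norm_nonneg _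
  · refine le_of_mul_le_mul_right ?_ h0
    nlinarith

/-- Robust aggregation contracts the squared disagreement. -/
theorem sum_norm_sub_mean_sq_aggregation_le {H : ℕ} (hH : 0 < H) {d : Type*} [Fintype d]
    (E : Matrix (Fin H) (Fin H) ℝ) (hE0 : ∀ i j, 0 ≤ E i j) (hErow : ∀ i, ∑ j, E i j = 1)
    {κ : ℝ} (hκ : κ = ‖LinearMap.toContinuousLinearMap (Matrix.toEuclideanLin
        (E - (Matrix.of fun _ _ => (H : ℝ)⁻¹ : Matrix (Fin H) (Fin H) ℝ) * E))‖ ^ 2)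
    {ρ : ℝ} (hρ : 0 ≤ ρ) (hle : κ + 8 * ρ * √(H : ℝ) ≤ 1)
    (Nb : Fin H → Finset (Fin H)) (hself : ∀ i, i ∈ Nb i)
    (y z : Fin H → EuclideanSpace ℝ d)
    (hagg : ∀ i, ‖z i - ∑ j, E i j • y j‖ ≤
      ρ * (Nb i).sup' ⟨i, hself i⟩ (fun j => ‖y j - ∑ j', E i j' • y j'‖)) :
    ∑ i, ‖z i - (H : ℝ)⁻¹ • ∑ j, z j‖ ^ 2 ≤
      (κ + 8 * ρ * √(H : ℝ)) * ∑ i, ‖y i - (H : ℝ)⁻¹ • ∑ j, y j‖ ^ 2 := by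
  have : Nonempty (Fin H) := ⟨⟨0, hH⟩⟩
  have hH0 : (H : ℝ) ≠ 0 := by positivity
  set m := (H : ℝ)⁻¹ • ∑ j, y j with hm
  set S := ∑ i, ‖y i - m‖ ^ 2 with hS
  have hS0 : 0 ≤ S := Finset.sum_nonneg fun _ _ => sq_nonneg _
  set w : Fin H → EuclideanSpace ℝ d := fun i => ∑ j, E i j • y j with hw
  set r := √(H : ℝ) with hr
  have hr0 : 0 ≤ r := Real.sqrt_nonneg _
  have hr2 : r ^ 2 = H := Real.sq_sqrt (Nat.cast_nonneg _)
  have hy : ∀ j, ‖y j - m‖ ≤ √S := norm_sub_le_sqrt_sum y m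
  have hwm : ∀ i, ‖w i - m‖ ≤ √S := fun i => by
    have : w i - m = ∑ j, E i j • (y j - m) := by
      simp only [hw, smul_sub, Finset.sum_sub_distrib, ← Finset.sum_smul, hErow, one_smul]
    rw [this]
    calc ‖∑ j, E i j • (y j - m)‖ ≤ ∑ j, E i j * √S := by
          refine (norm_sum_le _ _).trans (Finset.sum_le_sum fun j _ => ?_)
          rw [norm_smul, Real.norm_of_nonneg (hE0 i j)]
          exact mul_le_mul_of_nonneg_left (hy j) (hE0 i j)
      _ = √S := by rw [← Finset.sum_mul, hErow, one_mul]
  have herr : ∀ i, ‖z i - w i‖ ≤ ρ * (2 * √S) := fun i => by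
    refine (hagg i).trans (mul_le_mul_of_nonneg_left (Finset.sup'_le _ _ fun j _ => ?_) hρ)
    calc ‖y j - w i‖ = ‖(y j - m) - (w i - m)‖ := by rw [sub_sub_sub_cancel_right]
      _ ≤ 2 * √S := by linarith [norm_sub_le (y j - m) (w i - m), hy j, hwm i]
  have herrsum : ∑ i, ‖(z i - w i) - (H : ℝ)⁻¹ • ∑ j, (z j - w j)‖ ^ 2 ≤ (2 * ρ * r * √S) ^ 2 := by
    have h := sum_norm_sub_mean_sq_le (fun i => z i - w i) 0
    simp only [Fintype.card_fin, sub_zero] at h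
    refine h.trans ?_
    calc ∑ i, ‖z i - w i‖ ^ 2 ≤ ∑ _i : Fin H, (ρ * (2 * √S)) ^ 2 :=
          Finset.sum_le_sum fun i _ => pow_le_pow_left₀ (norm_nonneg _) (herr i) 2
      _ = r ^ 2 * (ρ * (2 * √S)) ^ 2 := by simp [hr2]
      _ = (2 * ρ * r * √S) ^ 2 := by ring
  set M := E - (Matrix.of fun _ _ => (H : ℝ)⁻¹ : Matrix (Fin H) (Fin H) ℝ) * E with hM
  have hMij : ∀ i j, M i j = E i j - (H : ℝ)⁻¹ * ∑ l, E l j := fun i j => by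
    simp [hM, Matrix.mul_apply, Finset.mul_sum]
  have hMrow : ∀ i, ∑ j, M i j = 0 := fun i => by
    simp only [hMij, Finset.sum_sub_distrib, ← Finset.mul_sum, hErow]
    rw [Finset.sum_comm]
    simp [hErow, hH0]
  have hdev : ∀ i, w i - (H : ℝ)⁻¹ • ∑ j, w j = ∑ j, M i j • (y j - m) := fun i => by
    simp only [smul_sub, Finset.sum_sub_distrib, ← Finset.sum_smul, hMrow, zero_smul, sub_zero]
    simp only [hMij, sub_smul, Finset.sum_sub_distrib, mul_smul, ← Finset.smul_sum, hw,
      Finset.sum_smul]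
    rw [Finset.sum_comm]
  have hκ0 : 0 ≤ κ := hκ ▸ sq_nonneg _
  have hmain : ∑ i, ‖w i - (H : ℝ)⁻¹ • ∑ j, w j‖ ^ 2 ≤ (√κ * √S) ^ 2 := by
    rw [mul_pow, Real.sq_sqrt hκ0, Real.sq_sqrt hS0, hκ]
    simp only [hdev]
    exact sum_norm_matrix_smul_sq_le M _
  have hsum := sum_norm_add_sq_le _ _ (by positivity) (by positivity) hmain herrsum
  have hz : ∀ i, (w i - (H : ℝ)⁻¹ • ∑ j, w j) + ((z i - w i) - (H : ℝ)⁻¹ • ∑ j, (z j - w j))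
      = z i - (H : ℝ)⁻¹ • ∑ j, z j := fun i => by
    rw [Finset.sum_sub_distrib, smul_sub]; abel
  simp only [hz] at hsum
  refine hsum.trans ?_
  have hfac : (√κ * √S + 2 * ρ * r * √S) ^ 2 = (√κ + 2 * (ρ * r)) ^ 2 * S := by
    rw [← Real.sq_sqrt hS0, Real.sqrt_sq (Real.sqrt_nonneg S)]; ring
  rw [hfac]
  refine mul_le_mul_of_nonneg_right ?_ hS0
  have hρr : 0 ≤ ρ * r := mul_nonneg hρ hr0
  have hsκ : √κ ≤ 1 := Real.sqrt_le_one.2 (by nlinarith)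
  nlinarith [Real.sq_sqrt hκ0, mul_le_mul_of_nonneg_left hsκ hρr]

/-- One local dual step, with `T i` a Lipschitz map whose disagreement at the mean is at most `Δ`. -/
theorem sum_norm_sub_mean_sq_step_le [Nonempty ι] (x : ι → V) (T : ι → V → V) (s : V)
    {u Δ c t : ℝ} (hu : 0 < u) (ht : 0 < t)
    (hT : ∀ i a b, u * ‖T i a - T i b‖ ≤ ‖a - b‖)
    (hΔ : ∀ a i, ‖T i a - (Fintype.card ι : ℝ)⁻¹ • ∑ j, T j a‖ ^ 2 ≤ Δ) :
    ∑ i, ‖(x i - c • (s - T i (x i))) -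
        (Fintype.card ι : ℝ)⁻¹ • ∑ j, (x j - c • (s - T j (x j)))‖ ^ 2 ≤
      (1 + t) * ∑ i, ‖x i - (Fintype.card ι : ℝ)⁻¹ • ∑ j, x j‖ ^ 2 +
      (1 + t⁻¹) * (c ^ 2 * (2 / u ^ 2 * ∑ i, ‖x i - (Fintype.card ι : ℝ)⁻¹ • ∑ j, x j‖ ^ 2 +
        2 * (Fintype.card ι * Δ))) := by
  set n : ℝ := (Fintype.card ι : ℝ) with hn
  set m := n⁻¹ • ∑ j, x j with hm
  set q := n⁻¹ • ∑ j, T j m with hq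
  refine (sum_norm_sub_mean_sq_le _ (m - c • (s - q))).trans ?_
  have hi : ∀ i, ‖(x i - c • (s - T i (x i))) - (m - c • (s - q))‖ ^ 2 ≤
      (1 + t) * ‖x i - m‖ ^ 2 + (1 + t⁻¹) * (c ^ 2 * (2 / u ^ 2 * ‖x i - m‖ ^ 2 + 2 * Δ)) := by
    intro i
    have hsplit : (x i - c • (s - T i (x i))) - (m - c • (s - q))
        = (x i - m) + c • ((T i (x i) - T i m) + (T i m - q)) := by
      module
    rw [hsplit]
    refine (norm_add_sq_le_young _ _ ht).trans ?_
    rw [norm_smul, mul_pow, Real.norm_eq_abs, sq_abs]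
    have h1 : ‖T i (x i) - T i m‖ ^ 2 ≤ ‖x i - m‖ ^ 2 / u ^ 2 := by
      rw [le_div_iff₀ (by positivity), mul_comm, ← mul_pow]
      exact pow_le_pow_left₀ (by positivity) (hT i _ _) 2
    have h2 := norm_add_sq_le_young (T i (x i) - T i m) (T i m - q) one_pos
    have h3 : ‖T i (x i) - T i m + (T i m - q)‖ ^ 2 ≤ 2 / u ^ 2 * ‖x i - m‖ ^ 2 + 2 * Δ := by
      have h4 := hΔ m i
      have h5 : 2 / u ^ 2 * ‖x i - m‖ ^ 2 = 2 * (‖x i - m‖ ^ 2 / u ^ 2) := by ring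
      rw [inv_one, one_add_one_eq_two] at h2
      linarith
    gcongr
  refine (Finset.sum_le_sum fun i _ => hi i).trans (le_of_eq ?_)
  simp only [Finset.sum_add_distrib, ← Finset.mul_sum, Finset.sum_const, Finset.card_univ,
    nsmul_eq_mul, ← hn]

theorem disagreement_recursion_le {ε c b b' x : ℝ} (hε0 : 0 < ε) (hε1 : ε ≤ 1) (hb : 0 ≤ b)
    (hc0 : 0 ≤ c) (hc : 18 * c / ε ≤ (2 - ε) * ε ^ 2 / (3 * (3 - ε)))
    (hb' : (2 - ε ^ 2) * b ≤ 2 * b') (hx : x ≤ 18 * b / ε ^ 3) :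
    (1 - ε) * ((1 + ε / 2) * x + (1 + (ε / 2)⁻¹) * (2 * c * x + 2 * b)) ≤ 18 * b' / ε ^ 3 := by
  have hc' : 81 * c ≤ ε ^ 3 := by
    rw [div_le_div_iff₀ hε0 (by linarith)] at hc
    have : 54 * (c * (3 - ε)) ≤ (2 - ε) * ε ^ 3 := by nlinarith
    nlinarith [pow_pos hε0 3, mul_nonneg hc0 hε0.le, mul_pos hε0 (pow_pos hε0 3)]
  have hε3 : 0 < ε ^ 3 := by positivity
  set y := b / ε ^ 3 with hy
  have hy0 : 0 ≤ y := by positivity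
  have hby : b = y * ε ^ 3 := by rw [hy]; field_simp
  have hx' : x ≤ 18 * y := by rw [hy]; convert hx using 1; ring
  have hinv : 1 + (ε / 2)⁻¹ = (ε + 2) / ε := by field_simp
  have hup : (1 - ε) * ((1 + ε / 2) * x + (1 + (ε / 2)⁻¹) * (2 * c * x + 2 * b)) ≤
      (1 - ε) * ((1 + ε / 2) * (18 * y)
        + (1 + (ε / 2)⁻¹) * (2 * (ε ^ 3 / 81) * (18 * y) + 2 * b)) := by
    have h1 : c * x ≤ ε ^ 3 / 81 * (18 * y) :=
      (mul_le_mul_of_nonneg_left hx' hc0).trans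
        (mul_le_mul_of_nonneg_right (by linarith) (by linarith))
    have h2 : 0 ≤ 1 - ε := by linarith
    rw [mul_assoc 2 c x, mul_assoc 2 (ε ^ 3 / 81)]
    gcongr
  refine hup.trans ?_
  have hlow : 9 * (2 - ε ^ 2) * y ≤ 18 * b' / ε ^ 3 := by
    rw [le_div_iff₀ hε3]
    rw [hby] at hb'
    linarith
  refine le_trans ?_ hlow
  rw [hinv, hby]
  have hid : (1 - ε) * ((1 + ε / 2) * (18 * y)
        + (ε + 2) / ε * (2 * (ε ^ 3 / 81) * (18 * y) + 2 * (y * ε ^ 3)))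
      = y * ((1 - ε) * ((1 + ε / 2) * 18 + (ε + 2) * ε ^ 2 * (22 / 9))) := by
    field_simp; ring
  rw [hid, mul_comm _ y]
  refine mul_le_mul_of_nonneg_left ?_ hy0
  nlinarith [mul_nonneg hε0.le (sub_nonneg.2 hε1), pow_pos hε0 3, pow_pos hε0 4]

end InnerProduct

theorem statement_9
    (D H J : ℕ) (hH : 0 < H) (hHJ : H ≤ J)
    (uf Lf : ℝ) (huf : 0 < uf) (hufLf : uf ≤ Lf)
    (f : Fin H → EuclideanSpace ℝ (Fin D) → ℝ)
    (C : Fin H → Set (EuclideanSpace ℝ (Fin D)))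
    (hCne : ∀ i, (C i).Nonempty)
    (hCcpt : ∀ i, IsCompact (C i))
    (hCcvx : ∀ i, Convex ℝ (C i))
    (hfsc : ∀ i, StrongConvexOn Set.univ uf (f i))
    (hfdiff : ∀ i, Differentiable ℝ (f i))
    (hfsm : ∀ i x y, ‖gradient (f i) x - gradient (f i) y‖ ≤ Lf * ‖x - y‖)
    (s : EuclideanSpace ℝ (Fin D))
    -- `prox i lam` is the minimizer of `θ ↦ ⟪lam, θ⟫ + f i θ` over `C i`
    (prox : Fin H → EuclideanSpace ℝ (Fin D) → EuclideanSpace ℝ (Fin D))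
    (hprox : ∀ i lam, prox i lam ∈ C i ∧
      ∀ θ ∈ C i, ⟪lam, prox i lam⟫_ℝ + f i (prox i lam) ≤ ⟪lam, θ⟫_ℝ + f i θ)
    -- conjugate functions and local dual functions of the honest agents
    (Fstar : Fin H → EuclideanSpace ℝ (Fin D) → ℝ)
    (hFstar : ∀ i lam, Fstar i lam = sSup ((fun θ => ⟪lam, θ⟫_ℝ - f i θ) '' C i))
    (g : Fin H → EuclideanSpace ℝ (Fin D) → ℝ)
    (hgdef : ∀ i lam, g i lam = (H : ℝ)⁻¹ * Fstar i (-lam) + (H : ℝ)⁻¹ * ⟪lam, s⟫_ℝ)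
    -- gradients of the local dual functions
    (gradg : Fin H → EuclideanSpace ℝ (Fin D) → EuclideanSpace ℝ (Fin D))
    (hgradg : ∀ i lam, gradg i lam = (H : ℝ)⁻¹ • s - (H : ℝ)⁻¹ • prox i lam)
    -- uniform bound on the deviation of the local dual gradients
    (δ : ℝ) (hδ0 : 0 ≤ δ)
    (hδ : ∀ (lam : EuclideanSpace ℝ (Fin D)) (i : Fin H),
      ‖gradg i lam - (H : ℝ)⁻¹ • ∑ j, gradg j lam‖ ^ 2 ≤ δ ^ 2)
    -- Definition 1: robust aggregation with contraction constant ρ and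
    -- row-stochastic virtual weight matrix Evw supported on honest neighborhoods
    (ρ : ℝ) (hρ0 : 0 ≤ ρ)
    (Nb : Fin H → Finset (Fin H)) (hself : ∀ i, i ∈ Nb i)
    (Evw : Matrix (Fin H) (Fin H) ℝ)
    (hEpos : ∀ i j, j ∈ Nb i → 0 < Evw i j ∧ Evw i j ≤ 1)
    (hEzero : ∀ i j, j ∉ Nb i → Evw i j = 0)
    (hErow : ∀ i, ∑ j, Evw i j = 1)
    (κ : ℝ)
    (hκ : κ = ‖LinearMap.toContinuousLinearMap (Matrix.toEuclideanLin
        (Evw - (Matrix.of fun _ _ => (H : ℝ)⁻¹ : Matrix (Fin H) (Fin H) ℝ) * Evw))‖ ^ 2)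
    (hκlt : κ < 1)
    (χsq : ℝ) (hχ : χsq = (H : ℝ)⁻¹ * ∑ j, ((∑ i, Evw i j) - 1) ^ 2)
    (ε : ℝ) (hε : ε = 1 - κ - 8 * ρ * Real.sqrt (H : ℝ))
    (hρκ : ρ < (1 - κ) / (8 * Real.sqrt (H : ℝ)))
    -- step-size conditions
    (γ : ℕ → ℝ) (hγpos : ∀ k, 0 < γ k)
    (hstep1 : ∀ k, 18 * (γ k) ^ 2 / (ε * uf ^ 2 * (J : ℝ) ^ 2) ≤ (2 - ε) * ε ^ 2 / (3 * (3 - ε)))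
    (hstep2 : ∀ k, 1 ≤ (γ k) ^ 2 / (γ (k + 1)) ^ 2 ∧ (γ k) ^ 2 / (γ (k + 1)) ^ 2 ≤ 2 / (2 - ε ^ 2))
    -- the Byzantine-resilient decentralized resource allocation algorithm
    (lam lamh θv : ℕ → Fin H → EuclideanSpace ℝ (Fin D))
    (lam0 : EuclideanSpace ℝ (Fin D)) (hinit : ∀ i, lam 0 i = lam0)
    (hθ : ∀ k i, θv k i = prox i (lam k i))
    (hhalf : ∀ k i, lamh k i = lam k i - γ k • ((J : ℝ)⁻¹ • s - (J : ℝ)⁻¹ • θv k i))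
    -- the aggregated iterate is ρ-close to the virtual weighted average
    (hagg : ∀ k i, ‖lam (k + 1) i - ∑ j, Evw i j • lamh k j‖ ≤
      ρ * (Nb i).sup' ⟨i, hself i⟩ (fun j => ‖lamh k j - ∑ j', Evw i j' • lamh k j'‖))
    :
    ∀ k : ℕ, ∑ i, ‖lam (k + 1) i - (H : ℝ)⁻¹ • ∑ j, lam (k + 1) j‖ ^ 2 ≤
      18 * (γ (k + 1)) ^ 2 * δ ^ 2 * (H : ℝ) ^ 3 / (ε ^ 3 * (J : ℝ) ^ 2) := by
  have hH' : (0 : ℝ) < H := by exact_mod_cast hH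
  have hJ' : (0 : ℝ) < J := by exact_mod_cast hH.trans_le hHJ
  have : Nonempty (Fin H) := ⟨⟨0, hH⟩⟩
  have hsqrt : 0 < √(H : ℝ) := Real.sqrt_pos.2 hH'
  have hε0 : 0 < ε := by
    rw [lt_div_iff₀ (by positivity)] at hρκ
    rw [hε]; linarith
  have hκ0 : 0 ≤ κ := hκ ▸ sq_nonneg _
  have hε1 : ε ≤ 1 := by
    have : 0 ≤ 8 * ρ * √(H : ℝ) := by positivity
    rw [hε]; linarith
  have hE0 : ∀ i j, 0 ≤ Evw i j := fun i j => by
    by_cases h : j ∈ Nb i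
    · exact (hEpos i j h).1.le
    · exact (hEzero i j h).ge
  have hcontr : κ + 8 * ρ * √(H : ℝ) = 1 - ε := by rw [hε]; ring
  have hlip : ∀ i a b, uf * ‖prox i a - prox i b‖ ≤ ‖a - b‖ := fun i a b =>
    (hfsc i).mul_norm_sub_le_of_isMinOn (hCcvx i) (hprox i a).1 (hprox i b).1
      (hprox i a).2 (hprox i b).2
  have hdis : ∀ a i, ‖prox i a - (Fintype.card (Fin H) : ℝ)⁻¹ • ∑ j, prox j a‖ ^ 2
      ≤ (H : ℝ) ^ 2 * δ ^ 2 := fun a i => by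
    have h := hδ a i
    have heq : gradg i a - (H : ℝ)⁻¹ • ∑ j, gradg j a
        = -((H : ℝ)⁻¹ • (prox i a - (H : ℝ)⁻¹ • ∑ j, prox j a)) := by
      simp only [hgradg, Finset.sum_sub_distrib, Finset.sum_const, Finset.card_univ,
        Fintype.card_fin, ← Finset.smul_sum, ← Nat.cast_smul_eq_nsmul ℝ]
      rw [smul_inv_smul₀ hH'.ne']
      module
    rw [heq, norm_neg, norm_smul, mul_pow, Real.norm_of_nonneg (by positivity), inv_pow,
      inv_mul_le_iff₀ (by positivity)] at h
    rwa [Fintype.card_fin]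
  have hbound : ∀ k, ∑ i, ‖lam k i - (H : ℝ)⁻¹ • ∑ j, lam k j‖ ^ 2 ≤
      18 * ((γ k / J) ^ 2 * ((H : ℝ) ^ 3 * δ ^ 2)) / ε ^ 3 := by
    intro k
    induction k with
    | zero =>
      have hzero : ∀ i, lam 0 i - (H : ℝ)⁻¹ • ∑ j, lam 0 j = 0 := fun i => by
        simp only [hinit, Finset.sum_const, Finset.card_univ, Fintype.card_fin,
          ← Nat.cast_smul_eq_nsmul ℝ]
        rw [inv_smul_smul₀ hH'.ne', sub_self]
      simp only [hzero]
      simp only [norm_zero, ne_eq, OfNat.ofNat_ne_zero, not_false_eq_true, zero_pow,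
        Finset.sum_const_zero]
      positivity
    | succ k ih =>
      have hstep := sum_norm_sub_mean_sq_step_le (lam k) prox s (c := γ k / J) huf
        (half_pos hε0) hlip hdis
      have hlamh : ∀ i, lamh k i = lam k i - (γ k / J) • (s - prox i (lam k i)) := fun i => by
        rw [hhalf, hθ, ← smul_sub, smul_smul, div_eq_mul_inv]
      simp only [← hlamh, Fintype.card_fin] at hstep
      have hagg' := sum_norm_sub_mean_sq_aggregation_le hH Evw hE0 hErow hκ hρ0
        (by rw [hcontr]; linarith) Nb hself (lamh k) (lam (k + 1)) (hagg k)
      rw [hcontr] at hagg'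
      refine hagg'.trans ((mul_le_mul_of_nonneg_left hstep (by linarith)).trans ?_)
      have hrec := disagreement_recursion_le (c := γ k ^ 2 / (uf ^ 2 * (J : ℝ) ^ 2))
        (b := (γ k / J) ^ 2 * ((H : ℝ) ^ 3 * δ ^ 2))
        (b' := (γ (k + 1) / J) ^ 2 * ((H : ℝ) ^ 3 * δ ^ 2)) hε0 hε1 (by positivity)
        (by positivity) ?_ ?_ ih
      · refine le_trans (le_of_eq ?_) hrec
        field_simp
      · refine le_trans (le_of_eq ?_) (hstep1 k)
        field_simp
      · have h := (hstep2 k).2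
        have hpos : 0 < 2 - ε ^ 2 := by nlinarith
        rw [div_le_div_iff₀ (pow_pos (hγpos _) 2) hpos] at h
        have hq : 0 ≤ (H : ℝ) ^ 3 * δ ^ 2 / (J : ℝ) ^ 2 := by positivity
        have h' := mul_le_mul_of_nonneg_right h hq
        calc _ = γ k ^ 2 * (2 - ε ^ 2) * ((H : ℝ) ^ 3 * δ ^ 2 / (J : ℝ) ^ 2) := by
              field_simp
          _ ≤ _ := h'
          _ = _ := by field_simp
  intro k
  refine (hbound (k + 1)).trans (le_of_eq ?_)
  field_simp
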